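/- Let T > 0 and let g be a Preisach density with Lipschitz bound μ ∈ L¹(0,∞) and M = ∫₀^∞ μ(r) dr. Let b, w₁, w₂ ∈ C[0,T] with 0 ≤ b(t) ≤ b̄ for all t ∈ [0,T]. Let q₁, q₂ : [0,T] → ℝ be absolutely continuous, for i = 1,2 and each r > 0 let ξ_r^i be the solution of the play variational inequality with threshold r and input q_i, and set P[q_i](t) := ∫₀^∞ g(r, ξ_r^i(t)) dr. Suppose that q_i(t) + b(t)·P[q_i](t) = w_i(t) for all t ∈ [0,T] and i = 1,2. Then max_{t∈[0,T]} |q₁(t) − q₂(t)| ≤ exp(b̄ M) · max_{t∈[0,T]} |w₁(t) − w₂(t)|. -/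

import Mathlib

open MeasureTheory Set

/-- `q` is absolutely continuous on `[0,T]` with a.e. derivative `q'`,
encoded via the fundamental theorem of calculus. -/
def IsACOn (T : ℝ) (q q' : ℝ → ℝ) : Prop :=
  IntegrableOn q' (Icc 0 T) ∧ ∀ t ∈ Icc 0 T, q t = q 0 + ∫ τ in (0:ℝ)..t, q' τ

/-- `ξ` (with a.e. derivative `ξ'`) solves the play variational inequality
with threshold `r` and input `q` on `[0,T]`:
(i) `|q - ξ| ≤ r` on `[0,T]`, (ii) `ξ'(t)(q(t) - ξ(t) - r z) ≥ 0` for a.e. `t`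
and all `z ∈ [-1,1]`, (iii) `ξ(0) = max{q(0) - r, min{0, q(0) + r}}`. -/
def IsPlaySol (T r : ℝ) (q ξ ξ' : ℝ → ℝ) : Prop :=
  IsACOn T ξ ξ' ∧
  (∀ t ∈ Icc 0 T, |q t - ξ t| ≤ r) ∧
  (∀ᵐ t ∂(volume.restrict (Ioo 0 T)),
    ∀ z ∈ Icc (-1:ℝ) 1, ξ' t * (q t - ξ t - r * z) ≥ 0) ∧
  ξ 0 = max (q 0 - r) (min 0 (q 0 + r))

/-- `g : (0,∞) × ℝ → ℝ` is a Preisach density with Lipschitz bound `μ`: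
`g` is measurable, `μ ∈ L¹(0,∞)`, and for a.e. `r > 0` one has `g(r,0) = 0`
and `v ↦ g(r,v)` is nondecreasing and Lipschitz with constant `μ(r) ≥ 0`. -/
def IsPreisachDensity (g : ℝ → ℝ → ℝ) (μ : ℝ → ℝ) : Prop :=
  Measurable (Function.uncurry g) ∧
  IntegrableOn μ (Ioi 0) ∧
  ∀ᵐ r ∂(volume.restrict (Ioi (0:ℝ))),
    g r 0 = 0 ∧ 0 ≤ μ r ∧ Monotone (g r) ∧
      LipschitzWith (Real.toNNReal (μ r)) (g r)


open Filter Topology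

/-! ### Comparison principles for the play operator -/

lemma IsACOn.continuousOn {T : ℝ} {q q' : ℝ → ℝ} (hT : 0 < T) (h : IsACOn T q q') :
    ContinuousOn q (Icc 0 T) := by
  have h1 : ContinuousOn (fun x => ∫ t in (0:ℝ)..x, q' t) (uIcc 0 T) :=
    intervalIntegral.continuousOn_primitive_interval (by rw [uIcc_of_le hT.le]; exact h.1)
  rw [uIcc_of_le hT.le] at h1
  exact (continuousOn_const.add h1).congr h.2

lemma IsACOn.sub_eq_integral {T : ℝ} {q q' : ℝ → ℝ} (h : IsACOn T q q') {a b : ℝ}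
    (ha : 0 ≤ a) (hab : a ≤ b) (hb : b ≤ T) : q b - q a = ∫ τ in a..b, q' τ := by
  have hi : ∀ x ∈ Icc 0 T, IntervalIntegrable q' volume 0 x := fun x hx =>
    (h.1.mono_set (by rw [uIcc_of_le hx.1]; exact Icc_subset_Icc_right hx.2)).intervalIntegrable
  rw [h.2 b ⟨ha.trans hab, hb⟩, h.2 a ⟨ha, hab.trans hb⟩, add_sub_add_left_eq_sub,
    intervalIntegral.integral_interval_sub_left (hi b ⟨ha.trans hab, hb⟩)
      (hi a ⟨ha, hab.trans hb⟩)]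

lemma IsACOn.neg {T : ℝ} {q q' : ℝ → ℝ} (h : IsACOn T q q') :
    IsACOn T (fun t => -q t) (fun t => -q' t) := by
  refine ⟨h.1.neg, fun t ht => ?_⟩
  dsimp only
  rw [intervalIntegral.integral_neg, h.2 t ht]
  ring

lemma IsPlaySol.le_of_lt_threshold {T r : ℝ} {q ξ ξ' : ℝ → ℝ} (h : IsPlaySol T r q ξ ξ')
    {a b : ℝ} (ha : 0 ≤ a) (hab : a ≤ b) (hb : b ≤ T)
    (hlt : ∀ t ∈ Icc a b, q t - ξ t < r) : ξ b ≤ ξ a := by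
  have hae : ∀ᵐ t ∂(volume.restrict (Ioc a b)), ξ' t ≤ 0 := by
    have h1 := h.2.2.1
    rw [restrict_Ioo_eq_restrict_Ioc] at h1
    filter_upwards [ae_restrict_of_ae_restrict_of_subset (Ioc_subset_Ioc ha hb) h1,
      ae_restrict_mem measurableSet_Ioc] with t ht htm
    have h2 := ht 1 (by norm_num)
    have h3 := hlt t (Ioc_subset_Icc_self htm)
    by_contra! hpos
    nlinarith
  have h2 := h.1.sub_eq_integral ha hab hb
  have h3 : ∫ τ in a..b, ξ' τ ≤ 0 := by
    rw [intervalIntegral.integral_of_le hab]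
    exact integral_nonpos_of_ae hae
  linarith

lemma IsPlaySol.neg {T r : ℝ} (hr : 0 < r) {q ξ ξ' : ℝ → ℝ} (h : IsPlaySol T r q ξ ξ') :
    IsPlaySol T r (fun t => -q t) (fun t => -ξ t) (fun t => -ξ' t) := by
  obtain ⟨hac, hb, hv, h0⟩ := h
  refine ⟨hac.neg, fun t ht => ?_, ?_, ?_⟩
  · have := hb t ht
    rwa [← abs_neg, show -(-q t - -ξ t) = q t - ξ t by ring]
  · filter_upwards [hv] with t ht z hz
    have := ht (-z) ⟨by linarith [hz.2], by linarith [hz.1]⟩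
    nlinarith
  · simp only [h0]
    grind

lemma IsPlaySol.ge_of_neg_threshold_lt {T r : ℝ} (hr : 0 < r) {q ξ ξ' : ℝ → ℝ}
    (h : IsPlaySol T r q ξ ξ') {a b : ℝ} (ha : 0 ≤ a) (hab : a ≤ b) (hb : b ≤ T)
    (hlt : ∀ t ∈ Icc a b, -r < q t - ξ t) : ξ a ≤ ξ b := by
  have := (h.neg hr).le_of_lt_threshold ha hab hb fun t ht => by linarith [hlt t ht]
  linarith

/-- The difference of two play outputs can only exceed its earlier values by starting there or at a
time when one of the two plays is at the appropriate end of its threshold. -/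
lemma IsPlaySol.exists_first_hit {T r₁ r₂ : ℝ} (hT : 0 < T) (hr₂ : 0 < r₂)
    {q₁ q₁' q₂ q₂' ξ₁ ξ₁' ξ₂ ξ₂' : ℝ → ℝ}
    (hq₁ : IsACOn T q₁ q₁') (hq₂ : IsACOn T q₂ q₂')
    (h₁ : IsPlaySol T r₁ q₁ ξ₁ ξ₁') (h₂ : IsPlaySol T r₂ q₂ ξ₂ ξ₂')
    {t : ℝ} (ht : t ∈ Icc 0 T) :
    ∃ τ ∈ Icc 0 T, ξ₁ t - ξ₂ t ≤ ξ₁ τ - ξ₂ τ ∧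
      (τ = 0 ∨ q₁ τ - ξ₁ τ = r₁ ∨ q₂ τ - ξ₂ τ = -r₂) := by
  have c₁ := h₁.1.continuousOn hT
  have c₂ := h₂.1.continuousOn hT
  have hcl : IsClosed (Icc 0 T ∩ (fun τ => ξ₁ τ - ξ₂ τ) ⁻¹' Ici (ξ₁ t - ξ₂ t)) :=
    (c₁.sub c₂).preimage_isClosed_of_isClosed isClosed_Icc isClosed_Ici
  obtain ⟨τ, ⟨hτ, hle⟩, hmin⟩ :=
    (isCompact_Icc.of_isClosed_subset hcl inter_subset_left).exists_isLeast ⟨t, ht, le_refl (ξ₁ t - ξ₂ t)⟩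
  refine ⟨τ, hτ, hle, ?_⟩
  by_contra! hcon
  obtain ⟨hτ0, hne₁, hne₂⟩ := hcon
  have hlt₁ : q₁ τ - ξ₁ τ < r₁ :=
    lt_of_le_of_ne (abs_le.1 (h₁.2.1 τ hτ)).2 hne₁
  have hlt₂ : -r₂ < q₂ τ - ξ₂ τ :=
    lt_of_le_of_ne (abs_le.1 (h₂.2.1 τ hτ)).1 hne₂.symm
  have hev := ((((hq₁.continuousOn hT).sub c₁) τ hτ).eventually_lt_const hlt₁).and
    ((((hq₂.continuousOn hT).sub c₂) τ hτ).eventually_const_lt hlt₂)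
  obtain ⟨ε, hε, hball⟩ := Metric.mem_nhdsWithin_iff.1 hev
  have hτpos : 0 < τ := lt_of_le_of_ne hτ.1 (Ne.symm hτ0)
  set σ := max 0 (τ - ε / 2) with hσ
  have hσ0 : 0 ≤ σ := le_max_left _ _
  have hστ : σ < τ := max_lt hτpos (by linarith)
  have hmem : ∀ s ∈ Icc σ τ, q₁ s - ξ₁ s < r₁ ∧ -r₂ < q₂ s - ξ₂ s := fun s hs => by
    refine hball ⟨?_, hσ0.trans hs.1, hs.2.trans hτ.2⟩
    rw [Metric.mem_ball, Real.dist_eq, abs_lt]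
    have := (le_max_right 0 (τ - ε / 2)).trans hs.1
    constructor <;> linarith [hs.2]
  have m₁ := h₁.le_of_lt_threshold hσ0 hστ.le hτ.2 fun s hs => (hmem s hs).1
  have m₂ := h₂.ge_of_neg_threshold_lt hr₂ hσ0 hστ.le hτ.2 fun s hs => (hmem s hs).2
  have hle' : ξ₁ t - ξ₂ t ≤ ξ₁ τ - ξ₂ τ := hle
  have : τ ≤ σ := hmin ⟨⟨hσ0, hστ.le.trans hτ.2⟩, show ξ₁ t - ξ₂ t ≤ ξ₁ σ - ξ₂ σ by linarith⟩
  linarith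

lemma isPlaySol_zero {T r : ℝ} (hr : 0 < r) :
    IsPlaySol T r (fun _ => 0) (fun _ => 0) (fun _ => 0) := by
  refine ⟨⟨integrableOn_zero, by simp⟩, by simp [hr.le], by simp, ?_⟩
  grind

lemma IsPlaySol.le_of_input_le {T r : ℝ} (hT : 0 < T) (hr : 0 < r) {q q' ξ ξ' : ℝ → ℝ} {C : ℝ}
    (hq : IsACOn T q q') (h : IsPlaySol T r q ξ ξ') (hC : ∀ t ∈ Icc 0 T, |q t| ≤ C)
    {t : ℝ} (ht : t ∈ Icc 0 T) : ξ t ≤ C := by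
  obtain ⟨τ, hτ, hle, hcase⟩ := IsPlaySol.exists_first_hit (q₂ := fun _ => 0) (q₂' := fun _ => 0)
    hT hr hq ⟨integrableOn_zero, by simp⟩ h (isPlaySol_zero hr) ht
  have hCτ := abs_le.1 (hC τ hτ)
  have h0 := h.2.2.2
  grind

lemma IsPlaySol.abs_output_le {T r : ℝ} (hT : 0 < T) (hr : 0 < r) {q q' ξ ξ' : ℝ → ℝ} {C : ℝ}
    (hq : IsACOn T q q') (h : IsPlaySol T r q ξ ξ') (hC : ∀ t ∈ Icc 0 T, |q t| ≤ C)
    {t : ℝ} (ht : t ∈ Icc 0 T) : |ξ t| ≤ C := by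
  exact abs_le'.2 ⟨h.le_of_input_le hT hr hq hC ht,
    (h.neg hr).le_of_input_le hT hr hq.neg (by simpa using hC) ht⟩

lemma IsPlaySol.sub_le_abs_sub {T r s : ℝ} (hT : 0 < T) (hr : 0 < r) (hs : 0 < s)
    {q q' ξ ξ' η η' : ℝ → ℝ} (hq : IsACOn T q q')
    (hξ : IsPlaySol T r q ξ ξ') (hη : IsPlaySol T s q η η') {t : ℝ} (ht : t ∈ Icc 0 T) :
    ξ t - η t ≤ |r - s| := by
  obtain ⟨τ, hτ, hle, hcase⟩ := IsPlaySol.exists_first_hit hT hs hq hq hξ hη ht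
  have b₁ := abs_le.1 (hξ.2.1 τ hτ)
  have b₂ := abs_le.1 (hη.2.1 τ hτ)
  have i₁ := hξ.2.2.2
  have i₂ := hη.2.2.2
  have := le_abs_self (r - s)
  have := neg_le_abs (r - s)
  rcases hcase with rfl | h | h
  · grind
  · linarith
  · linarith

/-- If the outputs with threshold `r` differ by `δ > 0`, then at some time the inputs differ by at
least `δ`, while all outputs with smaller thresholds are ordered. -/
lemma exists_time_sub_le {T : ℝ} (hT : 0 < T) {q₁ q₁' q₂ q₂' : ℝ → ℝ}
    (hq₁ : IsACOn T q₁ q₁') (hq₂ : IsACOn T q₂ q₂') {ξ₁ ξ₂ : ℝ → ℝ → ℝ}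
    (hξ₁ : ∀ ρ : ℝ, 0 < ρ → ∃ d, IsPlaySol T ρ q₁ (ξ₁ ρ) d)
    (hξ₂ : ∀ ρ : ℝ, 0 < ρ → ∃ d, IsPlaySol T ρ q₂ (ξ₂ ρ) d)
    {r t : ℝ} (hr : 0 < r) (ht : t ∈ Icc 0 T) (hpos : 0 < ξ₁ r t - ξ₂ r t) :
    ∃ τ ∈ Icc 0 T, ξ₁ r t - ξ₂ r t ≤ q₁ τ - q₂ τ ∧
      ∀ s, 0 < s → s < r → ξ₂ s τ ≤ ξ₁ s τ := by
  obtain ⟨d₁, h₁⟩ := hξ₁ r hr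
  obtain ⟨d₂, h₂⟩ := hξ₂ r hr
  obtain ⟨τ, hτ, hle, hcase⟩ := IsPlaySol.exists_first_hit hT hr hq₁ hq₂ h₁ h₂ ht
  have b₁ := abs_le.1 (h₁.2.1 τ hτ)
  have b₂ := abs_le.1 (h₂.2.1 τ hτ)
  have i₁ := h₁.2.2.2
  have i₂ := h₂.2.2.2
  refine ⟨τ, hτ, ?_, fun s hs hsr => ?_⟩
  · rcases hcase with rfl | h | h
    · refine hle.trans ?_
      grind
    · linarith
    · linarith
  · obtain ⟨e₁, k₁⟩ := hξ₁ s hs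
    obtain ⟨e₂, k₂⟩ := hξ₂ s hs
    have c₁ := abs_le.1 (k₁.2.1 τ hτ)
    have c₂ := abs_le.1 (k₂.2.1 τ hτ)
    have j₁ := k₁.2.2.2
    have j₂ := k₂.2.2.2
    have habs : |r - s| = r - s := abs_of_pos (by linarith)
    have l₁ := h₁.sub_le_abs_sub hT hr hs hq₁ k₁ hτ
    have l₂ := k₂.sub_le_abs_sub hT hs hr hq₂ h₂ hτ
    rw [abs_sub_comm] at l₂
    rw [habs] at l₁ l₂
    rcases hcase with rfl | h | h
    · grind
    · linarith
    · linarith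

/-! ### Exponential weights and a Gronwall-type argument -/

lemma antitoneOn_integral_Ioi {m : ℝ → ℝ} {a : ℝ} (hm : IntegrableOn m (Ioi a))
    (h0 : ∀ᵐ s ∂(volume.restrict (Ioi a)), 0 ≤ m s) :
    AntitoneOn (fun s => ∫ x in Ioi s, m x) (Ici a) := fun _ hx _ _ hxy =>
  setIntegral_mono_set (hm.mono_set (Ioi_subset_Ioi hx))
    (ae_restrict_of_ae_restrict_of_subset (Ioi_subset_Ioi hx) h0)
    (Ioi_subset_Ioi hxy).eventuallyLE

lemma integrableOn_mul_exp_integral_Ioi {m : ℝ → ℝ} {a : ℝ} (hm : IntegrableOn m (Ioi a))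
    (h0 : ∀ᵐ s ∂(volume.restrict (Ioi a)), 0 ≤ m s) :
    IntegrableOn (fun s => m s * Real.exp (∫ x in Ioi s, m x)) (Ioi a) := by
  have hanti := antitoneOn_integral_Ioi hm h0
  refine Integrable.mul_bdd (c := Real.exp (∫ x in Ioi a, m x)) hm ?_ ?_
  · exact (Real.measurable_exp.comp_aemeasurable (aemeasurable_restrict_of_antitoneOn
      measurableSet_Ioi (hanti.mono Ioi_subset_Ici_self))).aestronglyMeasurable
  · filter_upwards [ae_restrict_mem measurableSet_Ioi] with s hs
    rw [Real.norm_eq_abs, Real.abs_exp, Real.exp_le_exp]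
    exact hanti self_mem_Ici (mem_Ici_of_Ioi hs) (le_of_lt hs)

lemma integral_mul_exp_integral_Ioi_le {m : ℝ → ℝ} {a : ℝ} (hm : IntegrableOn m (Ioi a))
    (h0 : ∀ᵐ s ∂(volume.restrict (Ioi a)), 0 ≤ m s) :
    ∫ s in Ioi a, m s * Real.exp (∫ x in Ioi s, m x) ≤ Real.exp (∫ x in Ioi a, m x) - 1 := by
  have hanti := antitoneOn_integral_Ioi hm h0
  refine le_of_tendsto (intervalIntegral_tendsto_integral_Ioi a
    (integrableOn_mul_exp_integral_Ioi hm h0) tendsto_id) ?_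
  filter_upwards [eventually_ge_atTop a] with R hR
  simp only [id]
  set f : ℝ → ℝ := fun s => -Real.exp (∫ x in Ioi s, m x) with hf
  have hmono : MonotoneOn f (uIcc a R) := by
    rw [uIcc_of_le hR]
    intro x hx y hy hxy
    exact neg_le_neg (Real.exp_le_exp.2 (hanti hx.1 hy.1 hxy))
  have hle : ∫ s in a..R, deriv f s ≤ f R - f a := by
    have hmem := hmono.intervalIntegral_deriv_mem_uIcc
    rw [uIcc_of_le (sub_nonneg.2 (hmono left_mem_uIcc right_mem_uIcc hR))] at hmem
    exact hmem.2
  have hii : IntervalIntegrable m volume a R :=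
    (intervalIntegrable_iff_integrableOn_Ioc_of_le hR).2 (hm.mono_set Ioc_subset_Ioi_self)
  have hcongr : ∫ s in a..R, m s * Real.exp (∫ x in Ioi s, m x) = ∫ s in a..R, deriv f s := by
    refine intervalIntegral.integral_congr_ae ?_
    filter_upwards [hii.ae_hasDerivAt_integral] with x hx hxm
    rw [uIoc_of_le hR] at hxm
    have hd := hx (by rw [uIcc_of_le hR]; exact Ioc_subset_Icc_self hxm) a left_mem_uIcc
    have hN : HasDerivAt (fun s => ∫ y in Ioi s, m y) (-m x) x := by
      refine (hd.const_sub (∫ y in Ioi a, m y)).congr_of_eventuallyEq ?_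
      filter_upwards [Ioi_mem_nhds hxm.1] with s hs
      have := intervalIntegral.integral_interval_add_Ioi hm
        (hm.mono_set (Ioi_subset_Ioi (le_of_lt hs)))
      linarith
    have hf' : HasDerivAt f (-(Real.exp (∫ y in Ioi x, m y) * -m x)) x := hN.exp.neg
    rw [hf'.deriv]
    ring
  rw [hcongr]
  have hone : 1 ≤ Real.exp (∫ x in Ioi R, m x) := Real.one_le_exp <| integral_nonneg_of_ae
    (ae_restrict_of_ae_restrict_of_subset (Ioi_subset_Ioi hR) h0)
  simp only [hf] at hle ⊢
  linarith

lemma le_mul_of_self_improving {ι : Type*} {F φ : ι → ℝ} {C ε φ₀ : ℝ} (hε : 0 ≤ ε)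
    (hφ : ∀ i, 1 ≤ φ i) (hφ₀ : ∀ i, φ i ≤ φ₀) (hC : ∀ i, F i ≤ C)
    (h : ∀ K, 0 ≤ K → (∀ i, F i ≤ K * φ i) → ∀ i, F i ≤ ε + K * (φ i - 1)) (i : ι) :
    F i ≤ ε * φ i := by
  set S : Set ℝ := {K | 0 ≤ K ∧ ∀ i, F i ≤ K * φ i} with hS
  have hbdd : BddBelow S := ⟨0, fun K hK => hK.1⟩
  have hne : S.Nonempty := by
    refine ⟨max C 0, le_max_right _ _, fun j => ?_⟩
    exact ((hC j).trans (le_max_left _ _)).trans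
      (le_mul_of_one_le_right (le_max_right _ _) (hφ j))
  have hA : sInf S ∈ S := by
    refine ⟨le_csInf hne fun K hK => hK.1, fun j => ?_⟩
    rw [← div_le_iff₀ (by linarith [hφ j])]
    refine le_csInf hne fun K hK => ?_
    rw [div_le_iff₀ (by linarith [hφ j])]
    exact hK.2 j
  have hφ₀1 : 0 < φ₀ := by linarith [hφ i, hφ₀ i]
  have hAε : sInf S ≤ ε := by
    by_contra! hlt
    have hpos : 0 < (sInf S - ε) / φ₀ := div_pos (by linarith) hφ₀1
    have hle : (sInf S - ε) / φ₀ ≤ sInf S - ε :=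
      div_le_self (by linarith) ((hφ i).trans (hφ₀ i))
    have hmem : sInf S - (sInf S - ε) / φ₀ ∈ S := by
      refine ⟨by linarith, fun j => ?_⟩
      have h1 := h _ hA.1 hA.2 j
      have h2 : (sInf S - ε) / φ₀ * φ j ≤ (sInf S - ε) / φ₀ * φ₀ :=
        mul_le_mul_of_nonneg_left (hφ₀ j) hpos.le
      rw [div_mul_cancel₀ _ hφ₀1.ne'] at h2
      linarith
    linarith [csInf_le hbdd hmem]
  exact (hA.2 i).trans (mul_le_mul_of_nonneg_right hAε (by linarith [hφ i]))

/-! ### The Preisach operator -/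

lemma IsPreisachDensity.integrableOn_comp {g : ℝ → ℝ → ℝ} {μ : ℝ → ℝ}
    (hg : IsPreisachDensity g μ) {v : ℝ → ℝ} {C : ℝ}
    (hv : AEMeasurable v (volume.restrict (Ioi 0))) (hC : ∀ s, 0 < s → |v s| ≤ C) :
    IntegrableOn (fun s => g s (v s)) (Ioi 0) := by
  refine Integrable.mono' (hg.2.1.mul_const C)
    (hg.1.comp_aemeasurable (aemeasurable_id.prodMk hv)).aestronglyMeasurable ?_
  filter_upwards [hg.2.2, ae_restrict_mem measurableSet_Ioi] with s ⟨h0, hμ, _, hlip⟩ hs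
  have h1 := hlip.dist_le_mul (v s) 0
  rw [Real.dist_eq, Real.dist_eq, h0, sub_zero, sub_zero, Real.coe_toNNReal _ hμ] at h1
  exact h1.trans (mul_le_mul_of_nonneg_left (hC s hs) hμ)

lemma IsPreisachDensity.mul_integral_sub_le {g : ℝ → ℝ → ℝ} {μ : ℝ → ℝ}
    (hg : IsPreisachDensity g μ) {v₁ v₂ : ℝ → ℝ} {C c β K r : ℝ}
    (hv₁ : AEMeasurable v₁ (volume.restrict (Ioi 0)))
    (hv₂ : AEMeasurable v₂ (volume.restrict (Ioi 0)))
    (hC₁ : ∀ s, 0 < s → |v₁ s| ≤ C) (hC₂ : ∀ s, 0 < s → |v₂ s| ≤ C)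
    (hc : 0 ≤ c) (hcβ : c ≤ β) (hK : 0 ≤ K) (hr : 0 ≤ r)
    (hle : ∀ s, 0 < s → s < r → v₂ s ≤ v₁ s)
    (hbound : ∀ s, 0 < s → |v₁ s - v₂ s| ≤ K * Real.exp (∫ x in Ioi s, β * μ x)) :
    c * ((∫ s in Ioi 0, g s (v₂ s)) - ∫ s in Ioi 0, g s (v₁ s)) ≤
      K * (Real.exp (∫ x in Ioi r, β * μ x) - 1) := by
  have hm : IntegrableOn (fun s => β * μ s) (Ioi r) :=
    (hg.2.1.mono_set (Ioi_subset_Ioi hr)).const_mul β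
  have hm0 : ∀ᵐ s ∂(volume.restrict (Ioi r)), 0 ≤ β * μ s := by
    filter_upwards [ae_restrict_of_ae_restrict_of_subset (Ioi_subset_Ioi hr) hg.2.2] with s hs
    exact mul_nonneg (hc.trans hcβ) hs.2.1
  have hint := integrableOn_mul_exp_integral_Ioi hm hm0
  have hexp := integral_mul_exp_integral_Ioi_le hm hm0
  rw [← integral_sub (hg.integrableOn_comp hv₂ hC₂) (hg.integrableOn_comp hv₁ hC₁),
    ← integral_const_mul]
  refine le_trans ?_ (mul_le_mul_of_nonneg_left hexp hK)
  rw [← integral_const_mul, ← inter_eq_self_of_subset_right (Ioi_subset_Ioi hr),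
    ← setIntegral_indicator measurableSet_Ioi]
  refine integral_mono_ae (((hg.integrableOn_comp hv₂ hC₂).sub
    (hg.integrableOn_comp hv₁ hC₁)).const_mul c) ?_ ?_
  · rw [integrable_indicator_iff measurableSet_Ioi]
    exact IntegrableOn.mono_measure (hint.const_mul K) Measure.restrict_le_self
  · have hne : ∀ᵐ s ∂(volume.restrict (Ioi (0:ℝ))), s ≠ r :=
      ae_restrict_of_ae (by simp [ae_iff, measure_singleton])
    filter_upwards [hg.2.2, ae_restrict_mem measurableSet_Ioi, hne]
      with s ⟨h0, hμ, hmon, hlip⟩ hs hsr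
    by_cases h : s ∈ Ioi r
    · rw [indicator_of_mem h]
      have h1 := hlip.dist_le_mul (v₂ s) (v₁ s)
      rw [Real.dist_eq, dist_comm, Real.dist_eq, Real.coe_toNNReal _ hμ] at h1
      have h2 := (le_abs_self _).trans (h1.trans (mul_le_mul_of_nonneg_left (hbound s hs) hμ))
      have h3 : 0 ≤ μ s * (K * Real.exp (∫ x in Ioi s, β * μ x)) := by positivity
      calc _ ≤ c * (μ s * (K * Real.exp (∫ x in Ioi s, β * μ x))) :=
            mul_le_mul_of_nonneg_left h2 hc
        _ ≤ β * (μ s * (K * Real.exp (∫ x in Ioi s, β * μ x))) :=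
            mul_le_mul_of_nonneg_right hcβ h3
        _ = _ := by ring
    · rw [indicator_of_notMem h]
      have h1 := hmon (hle s hs (lt_of_le_of_ne (not_lt.1 h) hsr))
      exact mul_nonpos_of_nonneg_of_nonpos hc (sub_nonpos.2 h1)

lemma aemeasurable_play {T : ℝ} (hT : 0 < T) {q q' : ℝ → ℝ} (hq : IsACOn T q q')
    {ξ : ℝ → ℝ → ℝ} (hξ : ∀ ρ : ℝ, 0 < ρ → ∃ d, IsPlaySol T ρ q (ξ ρ) d)
    {t : ℝ} (ht : t ∈ Icc 0 T) :
    AEMeasurable (fun s => ξ s t) (volume.restrict (Ioi 0)) := by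
  have hlip : LipschitzOnWith 1 (fun s => ξ s t) (Ioi 0) := by
    refine LipschitzOnWith.of_le_add_mul 1 fun r hr s hs => ?_
    obtain ⟨d, hd⟩ := hξ r hr
    obtain ⟨e, he⟩ := hξ s hs
    have := hd.sub_le_abs_sub hT hr hs hq he ht
    rw [NNReal.coe_one, one_mul, Real.dist_eq]
    linarith
  exact hlip.continuousOn.aemeasurable measurableSet_Ioi

/-- `q` solves `q + b P[q] = w` on `[0,T]`, where `ξ` is the family of plays driven by `q`. -/
def IsPreisachInverse (T : ℝ) (g : ℝ → ℝ → ℝ) (b w q : ℝ → ℝ) (ξ : ℝ → ℝ → ℝ) : Prop :=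
  (∃ q', IsACOn T q q') ∧ (∀ ρ : ℝ, 0 < ρ → ∃ d, IsPlaySol T ρ q (ξ ρ) d) ∧
    ∀ t ∈ Icc 0 T, q t + b t * ∫ ρ in Ioi (0:ℝ), g ρ (ξ ρ t) = w t

lemma IsPreisachInverse.exists_abs_play_le {T : ℝ} (hT : 0 < T) {g : ℝ → ℝ → ℝ}
    {b w q : ℝ → ℝ} {ξ : ℝ → ℝ → ℝ} (h : IsPreisachInverse T g b w q ξ) :
    ∃ C, ∀ s, 0 < s → ∀ t ∈ Icc 0 T, |ξ s t| ≤ C := by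
  obtain ⟨⟨q', hq⟩, hξ, -⟩ := h
  obtain ⟨C, hC⟩ := isCompact_Icc.exists_bound_of_continuousOn (hq.continuousOn hT)
  refine ⟨C, fun s hs t ht => ?_⟩
  obtain ⟨d, hd⟩ := hξ s hs
  exact hd.abs_output_le hT hs hq hC ht

section Comparison

variable {T β ε K : ℝ} {g : ℝ → ℝ → ℝ} {μ b w₁ w₂ q₁ q₂ : ℝ → ℝ} {ξ₁ ξ₂ : ℝ → ℝ → ℝ}

lemma IsPreisachInverse.input_sub_le (hT : 0 < T) (hg : IsPreisachDensity g μ)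
    (hb : ∀ t ∈ Icc 0 T, 0 ≤ b t ∧ b t ≤ β)
    (h₁ : IsPreisachInverse T g b w₁ q₁ ξ₁) (h₂ : IsPreisachInverse T g b w₂ q₂ ξ₂)
    (hε : ∀ t ∈ Icc 0 T, |w₁ t - w₂ t| ≤ ε) (hK : 0 ≤ K)
    (hbound : ∀ s, 0 < s → ∀ t ∈ Icc 0 T,
      |ξ₁ s t - ξ₂ s t| ≤ K * Real.exp (∫ x in Ioi s, β * μ x))
    {r t : ℝ} (hr : 0 ≤ r) (ht : t ∈ Icc 0 T)
    (hle : ∀ s, 0 < s → s < r → ξ₂ s t ≤ ξ₁ s t) :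
    q₁ t - q₂ t ≤ ε + K * (Real.exp (∫ x in Ioi r, β * μ x) - 1) := by
  obtain ⟨C₁, hC₁⟩ := h₁.exists_abs_play_le hT
  obtain ⟨C₂, hC₂⟩ := h₂.exists_abs_play_le hT
  obtain ⟨⟨q₁', hq₁⟩, hξ₁, he₁⟩ := h₁
  obtain ⟨⟨q₂', hq₂⟩, hξ₂, he₂⟩ := h₂
  have h := hg.mul_integral_sub_le (C := max C₁ C₂) (aemeasurable_play hT hq₁ hξ₁ ht)
    (aemeasurable_play hT hq₂ hξ₂ ht) (fun s hs => (hC₁ s hs t ht).trans (le_max_left _ _))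
    (fun s hs => (hC₂ s hs t ht).trans (le_max_right _ _)) (hb t ht).1 (hb t ht).2 hK hr hle
    (fun s hs => hbound s hs t ht)
  have h' := (le_abs_self _).trans (hε t ht)
  have e₁ := he₁ t ht
  have e₂ := he₂ t ht
  linarith

lemma IsPreisachInverse.play_sub_le (hT : 0 < T) (hg : IsPreisachDensity g μ)
    (hb : ∀ t ∈ Icc 0 T, 0 ≤ b t ∧ b t ≤ β)
    (h₁ : IsPreisachInverse T g b w₁ q₁ ξ₁) (h₂ : IsPreisachInverse T g b w₂ q₂ ξ₂)
    (hε : ∀ t ∈ Icc 0 T, |w₁ t - w₂ t| ≤ ε) (hK : 0 ≤ K)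
    (hbound : ∀ s, 0 < s → ∀ t ∈ Icc 0 T,
      |ξ₁ s t - ξ₂ s t| ≤ K * Real.exp (∫ x in Ioi s, β * μ x))
    {r t : ℝ} (hr : 0 < r) (ht : t ∈ Icc 0 T) (hpos : 0 < ξ₁ r t - ξ₂ r t) :
    ξ₁ r t - ξ₂ r t ≤ ε + K * (Real.exp (∫ x in Ioi r, β * μ x) - 1) := by
  obtain ⟨q₁', hq₁⟩ := h₁.1
  obtain ⟨q₂', hq₂⟩ := h₂.1
  obtain ⟨τ, hτ, hle, hord⟩ := exists_time_sub_le hT hq₁ hq₂ h₁.2.1 h₂.2.1 hr ht hpos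
  exact hle.trans (h₁.input_sub_le hT hg hb h₂ hε hK hbound hr.le hτ hord)

lemma IsPreisachInverse.abs_play_sub_le (hT : 0 < T) (hg : IsPreisachDensity g μ)
    (hb : ∀ t ∈ Icc 0 T, 0 ≤ b t ∧ b t ≤ β)
    (h₁ : IsPreisachInverse T g b w₁ q₁ ξ₁) (h₂ : IsPreisachInverse T g b w₂ q₂ ξ₂)
    (hε : ∀ t ∈ Icc 0 T, |w₁ t - w₂ t| ≤ ε) {r t : ℝ} (hr : 0 < r) (ht : t ∈ Icc 0 T) :
    |ξ₁ r t - ξ₂ r t| ≤ ε * Real.exp (∫ x in Ioi r, β * μ x) := by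
  obtain ⟨C₁, hC₁⟩ := h₁.exists_abs_play_le hT
  obtain ⟨C₂, hC₂⟩ := h₂.exists_abs_play_le hT
  have hε0 : 0 ≤ ε := (abs_nonneg _).trans (hε t ht)
  have hβ : 0 ≤ β := (hb t ht).1.trans (hb t ht).2
  have hm : IntegrableOn (fun s => β * μ s) (Ioi 0) := hg.2.1.const_mul β
  have hm0 : ∀ᵐ s ∂(volume.restrict (Ioi 0)), 0 ≤ β * μ s := by
    filter_upwards [hg.2.2] with s hs
    exact mul_nonneg hβ hs.2.1
  have hφ : ∀ s, 0 < s → 1 ≤ Real.exp (∫ x in Ioi s, β * μ x) := fun s hs =>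
    Real.one_le_exp <| integral_nonneg_of_ae
      (ae_restrict_of_ae_restrict_of_subset (Ioi_subset_Ioi hs.le) hm0)
  refine le_mul_of_self_improving (ι := Ioi (0:ℝ) × Icc (0:ℝ) T)
    (F := fun p => |ξ₁ p.1 p.2 - ξ₂ p.1 p.2|)
    (φ := fun p => Real.exp (∫ x in Ioi (p.1 : ℝ), β * μ x))
    (φ₀ := Real.exp (∫ x in Ioi 0, β * μ x)) (C := C₁ + C₂) hε0 (fun p => hφ _ p.1.2)
    (fun p => Real.exp_le_exp.2 (antitoneOn_integral_Ioi hm hm0 self_mem_Ici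
      (mem_Ici_of_Ioi p.1.2) (le_of_lt p.1.2))) (fun p => ?_) ?_ (⟨r, hr⟩, ⟨t, ht⟩)
  · exact (abs_sub _ _).trans (add_le_add (hC₁ _ p.1.2 _ p.2.2) (hC₂ _ p.1.2 _ p.2.2))
  · rintro K hK hbound ⟨⟨s, hs⟩, ⟨τ, hτ⟩⟩
    have hbd : ∀ s, 0 < s → ∀ t ∈ Icc 0 T,
        |ξ₁ s t - ξ₂ s t| ≤ K * Real.exp (∫ x in Ioi s, β * μ x) :=
      fun s hs t ht => hbound (⟨s, hs⟩, ⟨t, ht⟩)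
    dsimp only
    rcases lt_trichotomy (ξ₁ s τ - ξ₂ s τ) 0 with h | h | h
    · rw [abs_of_neg h, neg_sub]
      exact h₂.play_sub_le hT hg hb h₁ (fun t ht => abs_sub_comm (w₁ t) _ ▸ hε t ht) hK
        (fun s hs t ht => abs_sub_comm (ξ₁ s t) _ ▸ hbd s hs t ht) hs hτ (by linarith)
    · rw [h, abs_zero]
      exact add_nonneg hε0 (mul_nonneg hK (sub_nonneg.2 (hφ s hs)))
    · rw [abs_of_pos h]
      exact h₁.play_sub_le hT hg hb h₂ hε hK hbd hs hτ h

lemma IsPreisachInverse.abs_input_sub_le (hT : 0 < T) (hg : IsPreisachDensity g μ)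
    (hb : ∀ t ∈ Icc 0 T, 0 ≤ b t ∧ b t ≤ β)
    (h₁ : IsPreisachInverse T g b w₁ q₁ ξ₁) (h₂ : IsPreisachInverse T g b w₂ q₂ ξ₂)
    (hε : ∀ t ∈ Icc 0 T, |w₁ t - w₂ t| ≤ ε) {t : ℝ} (ht : t ∈ Icc 0 T) :
    |q₁ t - q₂ t| ≤ Real.exp (∫ x in Ioi 0, β * μ x) * ε := by
  have hε0 : 0 ≤ ε := (abs_nonneg _).trans (hε t ht)
  have hε' : ∀ t ∈ Icc 0 T, |w₂ t - w₁ t| ≤ ε := fun t ht => abs_sub_comm (w₁ t) _ ▸ hε t ht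
  have e₁ := h₁.input_sub_le hT hg hb h₂ hε hε0
    (fun s hs t ht => h₁.abs_play_sub_le hT hg hb h₂ hε hs ht) le_rfl ht
    (fun s hs hs' => absurd hs hs'.not_gt)
  have e₂ := h₂.input_sub_le hT hg hb h₁ hε' hε0
    (fun s hs t ht => h₂.abs_play_sub_le hT hg hb h₁ hε' hs ht) le_rfl ht
    (fun s hs hs' => absurd hs hs'.not_gt)
  rw [abs_le]
  constructor <;> linarith

end Comparison

/-- Theorem 1: Lipschitz estimate `‖q₁ - q₂‖ ≤ exp(b̄ M) ‖w₁ - w₂‖` for the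
inversion of the Preisach operator with time dependent coefficient `b`. -/
theorem stmt_3 (T bbar M : ℝ) (hT : 0 < T)
    (g : ℝ → ℝ → ℝ) (μ : ℝ → ℝ) (hg : IsPreisachDensity g μ)
    (hM : M = ∫ ρ in Ioi (0:ℝ), μ ρ)
    (b w₁ w₂ : ℝ → ℝ) (hb : ContinuousOn b (Icc 0 T))
    (hw₁ : ContinuousOn w₁ (Icc 0 T)) (hw₂ : ContinuousOn w₂ (Icc 0 T))
    (hbrange : ∀ t ∈ Icc 0 T, 0 ≤ b t ∧ b t ≤ bbar)
    (q₁ q₂ q₁' q₂' : ℝ → ℝ) (hq₁ : IsACOn T q₁ q₁') (hq₂ : IsACOn T q₂ q₂')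
    (ξ₁ ξ₂ : ℝ → ℝ → ℝ)
    (hξ₁ : ∀ ρ : ℝ, 0 < ρ → ∃ d, IsPlaySol T ρ q₁ (ξ₁ ρ) d)
    (hξ₂ : ∀ ρ : ℝ, 0 < ρ → ∃ d, IsPlaySol T ρ q₂ (ξ₂ ρ) d)
    (heq₁ : ∀ t ∈ Icc 0 T, q₁ t + b t * ∫ ρ in Ioi (0:ℝ), g ρ (ξ₁ ρ t) = w₁ t)
    (heq₂ : ∀ t ∈ Icc 0 T, q₂ t + b t * ∫ ρ in Ioi (0:ℝ), g ρ (ξ₂ ρ t) = w₂ t) :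
    (⨆ t : Icc (0:ℝ) T, |q₁ t - q₂ t|) ≤
      Real.exp (bbar * M) * ⨆ t : Icc (0:ℝ) T, |w₁ t - w₂ t| := by
  have hbdd : BddAbove (range fun t : Icc (0:ℝ) T => |w₁ t - w₂ t|) := by
    obtain ⟨C, hC⟩ := isCompact_Icc.exists_bound_of_continuousOn (hw₁.sub hw₂)
    exact ⟨C, by rintro _ ⟨t, rfl⟩; exact hC t t.2⟩
  have hε : ∀ t ∈ Icc 0 T, |w₁ t - w₂ t| ≤ ⨆ t : Icc (0:ℝ) T, |w₁ t - w₂ t| :=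
    fun t ht => le_ciSup hbdd ⟨t, ht⟩
  have h₁ : IsPreisachInverse T g b w₁ q₁ ξ₁ := ⟨⟨q₁', hq₁⟩, hξ₁, heq₁⟩
  have h₂ : IsPreisachInverse T g b w₂ q₂ ξ₂ := ⟨⟨q₂', hq₂⟩, hξ₂, heq₂⟩
  have : Nonempty (Icc (0:ℝ) T) := ⟨⟨0, left_mem_Icc.2 hT.le⟩⟩
  rw [hM, ← integral_const_mul]
  exact ciSup_le fun t => h₁.abs_input_sub_le hT hg hbrange h₂ hε t.2
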